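/- For every α ∈ (0,1) and every integer p ≥ 1, the p×p real matrix K with entries K(i,j) = α^{max(i,j)} (indices i, j ranging over 1, …, p) is symmetric positive definite. -/

import Mathlib

open Matrix

lemma aux_telescope (f : ℕ → ℝ) (m n : ℕ) (h : m ≤ n) :
    ∑ k ∈ Finset.range n, (if m ≤ k then f k - f (k + 1) else 0) = f m - f n := by
  induction n, h using Nat.le_induction with
  | base =>
    rw [sub_self]
    apply Finset.sum_eq_zero
    intro k hk
    rw [if_neg (by simpa using hk)]
  | succ n hn ih =>
    rw [Finset.sum_range_succ, ih, if_pos hn]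
    ring

/-- For every `α ∈ (0,1)` and every integer `p ≥ 1`, the `p × p` stable spline kernel
matrix with entries `K(i,j) = α^(max i j)` (indices running over `1, …, p`, here realised
by `Fin p` with the exponent `max i j + 1`) is symmetric positive definite. -/
theorem stableSplineKernel_posDef
    (α : ℝ) (hα : α ∈ Set.Ioo (0 : ℝ) 1) (p : ℕ) (hp : 1 ≤ p) :
    (Matrix.of (fun i j : Fin p => α ^ (max (i : ℕ) (j : ℕ) + 1))).PosDef := by
  obtain ⟨h0, h1⟩ := hα
  let f : ℕ → ℝ := fun k => if k < p then α ^ (k + 1) else 0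
  let D : Matrix (Fin p) (Fin p) ℝ := Matrix.diagonal (fun k => f k - f (k + 1))
  let B : Matrix (Fin p) (Fin p) ℝ := Matrix.of (fun i k => if i ≤ k then 1 else 0)
  have hD : D.PosDef := by
    refine Matrix.PosDef.diagonal ?_
    intro k
    have hk := k.2
    simp only [f, hk, if_true]
    split_ifs
    · have : 0 < α ^ ((k : ℕ) + 1) := by positivity
      rw [pow_succ α ((k : ℕ) + 1)]
      nlinarith
    · have : 0 < α ^ ((k : ℕ) + 1) := by positivity
      linarith
  have hB : IsUnit B := by
    rw [Matrix.isUnit_iff_isUnit_det, Matrix.det_of_upperTriangular]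
    · simp [B]
    · intro i j hij
      have : ¬ i ≤ j := not_le.mpr hij
      simp [B, this]
  have key : Matrix.of (fun i j : Fin p => α ^ (max (i : ℕ) (j : ℕ) + 1)) = B * D * star B := by
    ext i j
    have hm : max (i : ℕ) (j : ℕ) < p := max_lt i.2 j.2
    have := aux_telescope f (max (i : ℕ) (j : ℕ)) p hm.le
    rw [Finset.sum_range] at this
    have e1 : f (max (i : ℕ) (j : ℕ)) = α ^ (max (i : ℕ) (j : ℕ) + 1) := if_pos hm
    have e2 : f p = 0 := if_neg (lt_irrefl p)
    rw [e1, e2, sub_zero] at this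
    rw [Matrix.of_apply, ← this, Matrix.mul_apply]
    refine Finset.sum_congr rfl fun k _ => ?_
    rw [Matrix.mul_diagonal]
    simp only [B, Matrix.star_apply, Matrix.of_apply, Fin.le_def, max_le_iff]
    by_cases a : (i : ℕ) ≤ k <;> by_cases b : (j : ℕ) ≤ k <;> simp [a, b]
  rw [key]
  exact (Matrix.IsUnit.posDef_star_right_conjugate_iff hB).2 hD
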